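/- Let 𝔞 be a finite-dimensional Lie algebra over a field F of prime characteristic. For every integer r with 0 ≤ r ≤ dim_F 𝔞 there exists a locally finite U(𝔞)-module N_r with injective dimension exactly r. -/

import Mathlib

open CategoryTheory

universe u

/-- The `n`-th Ext group over the `F`-algebra `R`, as a functor value on modules. -/
noncomputable def ExtGrp (F : Type u) [Field F] (R : Type u) [Ring R] [Algebra F R]
    (X M : ModuleCat.{u} R) (n : ℕ) : ModuleCat F :=
  ((Ext F (ModuleCat.{u} R) n).obj (Opposite.op X)).obj M

/-- `M` has injective dimension exactly `d`: all Ext groups `Ext^n(-, M)` vanish for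
`n > d`, and `Ext^d(X, M) ≠ 0` for some `X`. -/
def InjDimEq (F : Type u) [Field F] (R : Type u) [Ring R] [Algebra F R]
    (M : ModuleCat.{u} R) (d : ℕ) : Prop :=
  (∀ (X : ModuleCat.{u} R) (n : ℕ), d < n → Subsingleton (ExtGrp F R X M n)) ∧
  ∃ X : ModuleCat.{u} R, Nontrivial (ExtGrp F R X M d)

/-- A bundled `U(𝔞)`-module together with a compatible `F`-vector space structure. -/
structure LieRep (F : Type u) (L : Type u) [Field F] [LieRing L] [LieAlgebra F L] where
  carrier : Type u
  [isAddCommGroup : AddCommGroup carrier]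
  [isModU : Module (UniversalEnvelopingAlgebra F L) carrier]
  [isModF : Module F carrier]
  [isTower : IsScalarTower F (UniversalEnvelopingAlgebra F L) carrier]

attribute [instance] LieRep.isAddCommGroup LieRep.isModU LieRep.isModF LieRep.isTower

/-- A module is locally finite if every cyclic submodule is finite-dimensional over `F`. -/
def LieRep.IsLocallyFinite {F L : Type u} [Field F] [LieRing L] [LieAlgebra F L]
    (N : LieRep F L) : Prop :=
  ∀ m : N.carrier,
    Module.Finite F ((Submodule.span (UniversalEnvelopingAlgebra F L) {m}).restrictScalars F)

namespace PBW

open Finsupp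

section

variable {F L : Type*} [Field F] [LieRing L] [LieAlgebra F L] {d : ℕ}

/-- total degree of an exponent vector -/
def dg (c : Fin d → ℕ) : ℕ := ∑ i, c i

/-- unit exponent vector -/
def dl (i : Fin d) : Fin d → ℕ := Pi.single i 1

theorem dg_add (c c' : Fin d → ℕ) : dg (c + c') = dg c + dg c' := by
  simp [dg, Finset.sum_add_distrib]

theorem dg_dl (i : Fin d) : dg (dl i) = 1 := by
  simp [dg, dl]

theorem dg_zero : dg (0 : Fin d → ℕ) = 0 := by simp [dg]

variable (F) in
/-- basis monomial -/
noncomputable def mon (c : Fin d → ℕ) : (Fin d → ℕ) →₀ F := single c 1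

variable (F d) in
/-- span of monomials of degree less than n -/
noncomputable def Slt (n : ℕ) : Submodule F ((Fin d → ℕ) →₀ F) :=
  Finsupp.supported F F {c | dg c < n}

theorem mon_mem {c : Fin d → ℕ} {n : ℕ} (h : dg c < n) : mon F c ∈ Slt F d n :=
  Finsupp.single_mem_supported F 1 h

theorem Slt_le {n : ℕ} {N : Submodule F ((Fin d → ℕ) →₀ F)}
    (h : ∀ c, dg c < n → mon F c ∈ N) : Slt F d n ≤ N := by
  rw [Slt, Finsupp.supported_eq_span_single, Submodule.span_le]
  rintro _ ⟨c, hc, rfl⟩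
  exact h c hc

theorem Slt_mono {m n : ℕ} (h : m ≤ n) : Slt F d m ≤ Slt F d n :=
  Finsupp.supported_mono fun c (hc : dg c < m) => lt_of_lt_of_le hc h

/-- j is at most the least index of t -/
def IsMin (j : Fin d) (t : Fin d → ℕ) : Prop := ∀ k < j, t k = 0

theorem isMin_unique {j j' : Fin d} {t t' : Fin d → ℕ} (h : IsMin j t) (h' : IsMin j' t')
    (e : t + dl j = t' + dl j') : j = j' ∧ t = t' := by
  have key : ∀ {j j' : Fin d} {t t' : Fin d → ℕ}, IsMin j' t' →
      t + dl j = t' + dl j' → ¬ j < j' := by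
    intro j j' t t' h' e hlt
    have := congrFun e j
    simp [dl, h' j hlt, hlt.ne] at this
  have hj : j = j' := le_antisymm (not_lt.1 (key h e.symm)) (not_lt.1 (key h' e))
  subst hj
  exact ⟨rfl, add_right_cancel e⟩

theorem exists_min {c : Fin d → ℕ} (hc : c ≠ 0) :
    ∃ j t, IsMin j t ∧ c = t + dl j := by
  classical
  have hne : (Finset.univ.filter fun i => c i ≠ 0).Nonempty := by
    obtain ⟨i, hi⟩ := Function.ne_iff.1 hc
    exact ⟨i, by simpa using hi⟩
  set j := (Finset.univ.filter fun i => c i ≠ 0).min' hne with hj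
  have hj0 : c j ≠ 0 := by
    have := Finset.min'_mem _ hne
    simpa using this
  have hm : ∀ k < j, c k = 0 := by
    intro k hk
    by_contra h0
    exact absurd (Finset.min'_le _ k (by simpa using h0)) (not_le.2 hk)
  refine ⟨j, c - dl j, fun k hk => by simp [hm k hk], ?_⟩
  funext k
  by_cases hk : k = j
  · subst hk
    simp [dl]; omega
  · simp [dl, hk]

variable (b : Module.Basis (Fin d) F L)

open Classical in
/-- recursion step -/
noncomputable def step (R : Fin d → (((Fin d → ℕ) →₀ F) →ₗ[F] ((Fin d → ℕ) →₀ F)))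
    (i : Fin d) (c : Fin d → ℕ) : (Fin d → ℕ) →₀ F :=
  if h : ∃ q : Fin d × (Fin d → ℕ), q.1 < i ∧ IsMin q.1 q.2 ∧ c = q.2 + dl q.1 then
    mon F (c + dl i) + R h.choose.1 (R i (mon F h.choose.2) - mon F (h.choose.2 + dl i))
      + b.constr F R ⁅b i, b h.choose.1⁆ (mon F h.choose.2)
  else mon F (c + dl i)

/-- approximations of the action -/
noncomputable def lev : ℕ → Fin d → (((Fin d → ℕ) →₀ F) →ₗ[F] ((Fin d → ℕ) →₀ F))
  | 0 => fun i => linearCombination F (fun c => mon F (c + dl i))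
  | n + 1 => fun i => linearCombination F
      (fun c => if dg c ≤ n then lev n i (mon F c) else step b (lev n) i c)

theorem lev_zero (i : Fin d) (c : Fin d → ℕ) : lev b 0 i (mon F c) = mon F (c + dl i) := by
  simp [lev, mon]

theorem lev_succ (n : ℕ) (i : Fin d) (c : Fin d → ℕ) : lev b (n + 1) i (mon F c) =
    if dg c ≤ n then lev b n i (mon F c) else step b (lev b n) i c := by
  simp [lev, mon]

/-- the action of basis elements -/
noncomputable def act (i : Fin d) : ((Fin d → ℕ) →₀ F) →ₗ[F] ((Fin d → ℕ) →₀ F) :=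
  linearCombination F (fun c => lev b (dg c) i (mon F c))

theorem act_mon (i : Fin d) (c : Fin d → ℕ) :
    act b i (mon F c) = lev b (dg c) i (mon F c) := by
  simp [act, mon]

theorem lev_eq (n : ℕ) (i : Fin d) (c : Fin d → ℕ) (h : dg c ≤ n) :
    lev b n i (mon F c) = act b i (mon F c) := by
  rw [act_mon]
  induction n with
  | zero => rw [Nat.le_zero.1 h]
  | succ n ih =>
    rcases Nat.lt_or_ge n (dg c) with h' | h'
    · rw [le_antisymm h h']
    · rw [lev_succ, if_pos h', ih h']

theorem lev_eq_of_mem (n : ℕ) (i : Fin d) (w : (Fin d → ℕ) →₀ F) (h : w ∈ Slt F d (n + 1)) :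
    lev b n i w = act b i w := by
  have : Slt F d (n + 1) ≤ LinearMap.ker (lev b n i - act b i) :=
    Slt_le fun c hc => by simp [lev_eq b n i c (Nat.lt_succ_iff.1 hc)]
  simpa [sub_eq_zero] using this h

/-- the action of the Lie algebra -/
noncomputable def actL : L →ₗ[F] (((Fin d → ℕ) →₀ F) →ₗ[F] ((Fin d → ℕ) →₀ F)) :=
  b.constr F (act b)

theorem actL_basis (i : Fin d) : actL b (b i) = act b i := by simp [actL]

theorem constr_apply_eq (R : Fin d → (((Fin d → ℕ) →₀ F) →ₗ[F] ((Fin d → ℕ) →₀ F)))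
    (x : L) (w : (Fin d → ℕ) →₀ F) : b.constr F R x w = ∑ k, b.repr x k • R k w := by
  simp [Module.Basis.constr_apply_fintype, LinearMap.sum_apply]

theorem act_of_isMin {i : Fin d} {c : Fin d → ℕ} (h : IsMin i c) :
    act b i (mon F c) = mon F (c + dl i) := by
  rw [act_mon]
  cases hn : dg c with
  | zero => rw [lev_zero]
  | succ n =>
    rw [lev_succ, if_neg (by omega), step, dif_neg]
    rintro ⟨⟨j, t⟩, h1, h2, rfl⟩
    have := h j h1
    simp [dl] at this

theorem act_rec_aux {i j : Fin d} {t : Fin d → ℕ} (hji : j < i) (h : IsMin j t) :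
    act b i (mon F (t + dl j)) = mon F (t + dl j + dl i)
      + lev b (dg t) j (act b i (mon F t) - mon F (t + dl i))
      + actL b ⁅b i, b j⁆ (mon F t) := by
  have hdeg : dg (t + dl j) = dg t + 1 := by rw [dg_add, dg_dl]
  rw [act_mon, hdeg, lev_succ, if_neg (by omega), step]
  have hex : ∃ q : Fin d × (Fin d → ℕ), q.1 < i ∧ IsMin q.1 q.2 ∧ t + dl j = q.2 + dl q.1 :=
    ⟨(j, t), hji, h, rfl⟩
  rw [dif_pos hex]
  obtain ⟨h1, h2⟩ := isMin_unique h hex.choose_spec.2.1 hex.choose_spec.2.2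
  rw [← h1, ← h2, lev_eq b _ i t le_rfl, actL, constr_apply_eq, constr_apply_eq]
  congr 1
  exact Finset.sum_congr rfl fun k _ => by rw [lev_eq b _ k t le_rfl]

theorem act_mem_of (n : ℕ)
    (h : ∀ i (c : Fin d → ℕ), dg c < n →
      act b i (mon F c) - mon F (c + dl i) ∈ Slt F d (dg c + 1))
    (i : Fin d) {w : (Fin d → ℕ) →₀ F} (hw : w ∈ Slt F d n) : act b i w ∈ Slt F d (n + 1) := by
  have : Slt F d n ≤ (Slt F d (n + 1)).comap (act b i) := Slt_le fun c hc => by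
    have h1 := Slt_mono (show dg c + 1 ≤ n + 1 by omega) (h i c hc)
    have h2 : mon F (c + dl i) ∈ Slt F d (n + 1) := mon_mem (by rw [dg_add, dg_dl]; omega)
    simpa using add_mem h1 h2
  exact this hw

theorem act_sub_mem (i : Fin d) (c : Fin d → ℕ) :
    act b i (mon F c) - mon F (c + dl i) ∈ Slt F d (dg c + 1) := by
  suffices ∀ n, ∀ i (c : Fin d → ℕ), dg c < n →
      act b i (mon F c) - mon F (c + dl i) ∈ Slt F d (dg c + 1) from
    this (dg c + 1) i c (Nat.lt_succ_self _)
  intro n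
  induction n with
  | zero => intro i c h; omega
  | succ n ih =>
    intro i c hc
    by_cases hm : IsMin i c
    · rw [act_of_isMin b hm, sub_self]; exact zero_mem _
    have hc0 : c ≠ 0 := by rintro rfl; exact hm fun _ _ => rfl
    obtain ⟨j, t, hj, rfl⟩ := exists_min hc0
    have hji : j < i := by
      by_contra hle
      refine hm fun k hk => ?_
      have hkj : k < j := lt_of_lt_of_le hk (not_lt.1 hle)
      simp [dl, hj k hkj, hkj.ne]
    have hdeg : dg (t + dl j) = dg t + 1 := by rw [dg_add, dg_dl]
    rw [act_rec_aux b hji hj, hdeg]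
    have h1 := ih i t (by omega)
    rw [lev_eq_of_mem b _ _ _ h1, add_assoc (mon F _), add_sub_cancel_left]
    have ih' := fun i (c : Fin d → ℕ) (h : dg c < dg t + 1) => ih i c (by omega)
    refine add_mem (act_mem_of b _ ih' j h1) ?_
    rw [actL, constr_apply_eq]
    exact sum_mem fun k _ => Submodule.smul_mem _ _ (act_mem_of b _ ih' k (mon_mem (by omega)))

theorem act_mem (n : ℕ) (i : Fin d) {w : (Fin d → ℕ) →₀ F} (hw : w ∈ Slt F d n) :
    act b i w ∈ Slt F d (n + 1) :=
  act_mem_of b n (fun i c _ => act_sub_mem b i c) i hw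

theorem act_rec {i j : Fin d} {t : Fin d → ℕ} (hji : j < i) (h : IsMin j t) :
    act b i (mon F (t + dl j)) = act b j (act b i (mon F t))
      + actL b ⁅b i, b j⁆ (mon F t) := by
  have h' : IsMin j (t + dl i) := fun k hk => by
    simp [dl, h k hk, (hk.trans hji).ne]
  rw [act_rec_aux b hji h, lev_eq_of_mem b _ _ _ (act_sub_mem b i t), map_sub,
    act_of_isMin b h', add_right_comm t]
  abel

@[elab_as_elim]
theorem basis_ind {P : L → Prop} (x : L) (zero : P 0) (add : ∀ x y, P x → P y → P (x + y))
    (smul : ∀ (a : F) x, P x → P (a • x)) (bas : ∀ i, P (b i)) : P x := by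
  have hx : x ∈ Submodule.span F (Set.range b) := by rw [b.span_eq]; trivial
  induction hx using Submodule.span_induction with
  | mem x h => obtain ⟨i, rfl⟩ := h; exact bas i
  | zero => exact zero
  | add x y _ _ hx hy => exact add x y hx hy
  | smul a x _ hx => exact smul a x hx

/-- commutation on a vector -/
def Comm (w : (Fin d → ℕ) →₀ F) : Prop :=
  ∀ x y : L, actL b x (actL b y w) - actL b y (actL b x w) = actL b ⁅x, y⁆ w

theorem comm_of_basis (w : (Fin d → ℕ) →₀ F)
    (h : ∀ i j : Fin d, j < i →
      act b i (act b j w) - act b j (act b i w) = actL b ⁅b i, b j⁆ w) : Comm b w := by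
  have h' : ∀ i j : Fin d,
      act b i (act b j w) - act b j (act b i w) = actL b ⁅b i, b j⁆ w := by
    intro i j
    rcases lt_trichotomy i j with hij | rfl | hij
    · rw [← neg_inj, neg_sub, h j i hij, ← lie_skew, map_neg, LinearMap.neg_apply]
    · simp
    · exact h i j hij
  intro x y
  refine basis_ind b x ?_ ?_ ?_ ?_
  · simp
  · intro x x' hx hx'
    simp only [map_add, LinearMap.add_apply, add_lie] at *
    rw [← hx, ← hx']; abel
  · intro a x hx
    simp only [map_smul, LinearMap.smul_apply, smul_lie] at *
    rw [← hx, smul_sub]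
  intro i
  refine basis_ind b y ?_ ?_ ?_ ?_
  · simp
  · intro x x' hx hx'
    simp only [map_add, LinearMap.add_apply, lie_add] at *
    rw [← hx, ← hx']; abel
  · intro a x hx
    simp only [map_smul, LinearMap.smul_apply, lie_smul] at *
    rw [← hx, smul_sub]
  · intro j
    simpa [actL_basis] using h' i j

theorem comm_of_mem {n : ℕ} (h : ∀ c : Fin d → ℕ, dg c < n → Comm b (mon F c))
    {w : (Fin d → ℕ) →₀ F} (hw : w ∈ Slt F d n) : Comm b w := by
  intro x y
  have : Slt F d n ≤ LinearMap.ker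
      (actL b x ∘ₗ actL b y - actL b y ∘ₗ actL b x - actL b ⁅x, y⁆) := Slt_le fun c hc => by
    simp [h c hc x y]
  simpa [sub_eq_zero] using this hw

theorem comm_isMin {i j : Fin d} {c : Fin d → ℕ} (hji : j < i) (h : IsMin j c) :
    act b i (act b j (mon F c)) - act b j (act b i (mon F c)) = actL b ⁅b i, b j⁆ (mon F c) := by
  rw [act_of_isMin b h, act_rec b hji h]; abel

theorem comm_mon (c : Fin d → ℕ) : Comm b (mon F c) := by
  suffices ∀ n, ∀ c : Fin d → ℕ, dg c < n → Comm b (mon F c) from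
    this (dg c + 1) c (Nat.lt_succ_self _)
  intro n
  induction n with
  | zero => intro c h; omega
  | succ n ih =>
    intro c hc
    refine comm_of_basis b _ fun i j hji => ?_
    by_cases hm : IsMin j c
    · exact comm_isMin b hji hm
    have hc0 : c ≠ 0 := by rintro rfl; exact hm fun _ _ => rfl
    obtain ⟨k, t, hk, rfl⟩ := exists_min hc0
    have hkj : k < j := by
      by_contra hle
      refine hm fun l hl => ?_
      have hkj : l < k := lt_of_lt_of_le hl (not_lt.1 hle)
      simp [dl, hk l hkj, hkj.ne]
    have hdeg : dg (t + dl k) = dg t + 1 := by rw [dg_add, dg_dl]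
    have hki := hkj.trans hji
    have ht : Comm b (mon F t) := ih t (by omega)
    have hlow : ∀ w ∈ Slt F d (dg t + 1), Comm b w := fun w hw =>
      comm_of_mem b (fun c hc => ih c (by omega)) hw
    -- commutation of e_k past e_l on e_m t
    have key : ∀ l m : Fin d, k < l → k < m →
        act b l (act b k (act b m (mon F t))) = act b k (act b l (act b m (mon F t)))
          + actL b ⁅b l, b k⁆ (act b m (mon F t)) := by
      intro l m hkl hkm
      have h1 := hlow _ (act_sub_mem b m t) (b l) (b k)
      have h2 := comm_isMin b hkl (c := t + dl m)
        (fun r hr => by simp [dl, hk r hr, (hr.trans hkm).ne])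
      simp only [actL_basis, map_sub] at h1
      rw [← sub_eq_iff_eq_add', ← sub_add_cancel (actL b ⁅b l, b k⁆ (act b m (mon F t)))
        (actL b ⁅b l, b k⁆ (mon F (t + dl m))), ← h1, ← h2]
      abel
    have hmon : mon F (t + dl k) = act b k (mon F t) := (act_of_isMin b hk).symm
    have e1 : ∀ l : Fin d, act b l (act b k (mon F t)) = act b k (act b l (mon F t))
        + actL b ⁅b l, b k⁆ (mon F t) := by
      intro l
      have := ht (b l) (b k)
      simp only [actL_basis] at this
      rw [← this]; abel
    have e2 : ∀ (l : Fin d) (x : L), act b l (actL b x (mon F t)) =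
        actL b x (act b l (mon F t)) + actL b ⁅b l, x⁆ (mon F t) := by
      intro l x
      have := ht (b l) x
      simp only [actL_basis] at this
      rw [← this]; abel
    have e3 := ht ⁅b i, b j⁆ (b k)
    have e4 := ht (b i) (b j)
    simp only [actL_basis] at e3 e4
    have jac : ⁅⁅b i, b j⁆, b k⁆ = ⁅b i, ⁅b j, b k⁆⁆ - ⁅b j, ⁅b i, b k⁆⁆ := lie_lie _ _ _
    rw [hmon, e1 i, e1 j, map_add, map_add, key i j hki hkj, key j i hkj hki, e2, e2,
      ← sub_eq_zero, sub_eq_iff_eq_add.1 e3, jac, ← e4]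
    simp only [map_sub, LinearMap.sub_apply]
    abel

theorem comm_all (w : (Fin d → ℕ) →₀ F) : Comm b w := by
  intro x y
  have : actL b x ∘ₗ actL b y - actL b y ∘ₗ actL b x - actL b ⁅x, y⁆ = 0 := by
    refine Finsupp.lhom_ext' fun c => LinearMap.ext_ring ?_
    have := comm_mon b c x y
    rw [← sub_eq_zero] at this
    exact this
  have := LinearMap.congr_fun this w
  simpa [sub_eq_zero] using this

attribute [local instance] LieRing.ofAssociativeRing

/-- the representation as a Lie algebra morphism -/
noncomputable def actHom : L →ₗ⁅F⁆ Module.End F ((Fin d → ℕ) →₀ F) :=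
  { actL b with
    map_lie' := by
      intro x y
      refine LinearMap.ext fun w => ?_
      exact (comm_all b w x y).symm }

/-- the representation of the enveloping algebra -/
noncomputable def rep : UniversalEnvelopingAlgebra F L →ₐ[F] Module.End F ((Fin d → ℕ) →₀ F) :=
  UniversalEnvelopingAlgebra.lift F (actHom b)

/-- generators -/
noncomputable def gen (i : Fin d) : UniversalEnvelopingAlgebra F L :=
  UniversalEnvelopingAlgebra.ι F (b i)

theorem rep_ι (x : L) : rep b (UniversalEnvelopingAlgebra.ι F x) = actL b x :=
  UniversalEnvelopingAlgebra.lift_ι_apply F (actHom b) x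

theorem rep_gen (i : Fin d) : rep b (gen b i) = act b i := by
  rw [gen, rep_ι, actL_basis]

/-- sorted monomials -/
noncomputable def smon (c : Fin d → ℕ) : UniversalEnvelopingAlgebra F L :=
  ((List.finRange d).map fun i => gen b i ^ c i).prod

theorem smon_zero : smon b 0 = 1 := by
  unfold smon
  apply List.prod_eq_one
  simp

theorem smon_add {j : Fin d} {t : Fin d → ℕ} (h : IsMin j t) :
    smon b (t + dl j) = gen b j * smon b t := by
  have key : ∀ l : List (Fin d), l.Pairwise (· < ·) → j ∈ l →
      (l.map fun i => gen b i ^ (t + dl j) i).prod = gen b j * (l.map fun i => gen b i ^ t i).prod := by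
    intro l
    induction l with
    | nil => intro _ h; simp at h
    | cons a l ih =>
      intro hp hj
      rw [List.pairwise_cons] at hp
      simp only [List.map_cons, List.prod_cons]
      by_cases haj : j = a
      · subst haj
        have : (l.map fun i => gen b i ^ (t + dl j) i) = l.map fun i => gen b i ^ t i := by
          refine List.map_congr_left fun i hi => ?_
          simp [dl, (hp.1 i hi).ne']
        rw [this, ← mul_assoc]
        simp [dl, pow_succ']
      · have hjl : j ∈ l := by simpa [haj] using hj
        have haj' := hp.1 j hjl
        rw [ih hp.2 hjl]
        simp [dl, h a haj', haj'.ne]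
  exact key _ (List.pairwise_lt_finRange d) (List.mem_finRange j)

theorem rep_smon (c : Fin d → ℕ) : rep b (smon b c) (mon F 0) = mon F c := by
  induction hn : dg c generalizing c with
  | zero =>
    have : c = 0 := by
      by_contra h
      obtain ⟨j, t, -, rfl⟩ := exists_min h
      rw [dg_add, dg_dl] at hn; omega
    subst this; simp [smon_zero]
  | succ n ih =>
    have h : c ≠ 0 := by rintro rfl; rw [dg_zero] at hn; omega
    obtain ⟨j, t, hj, rfl⟩ := exists_min h
    rw [dg_add, dg_dl] at hn
    rw [smon_add b hj, map_mul, Module.End.mul_apply, ih t (by omega), rep_gen, act_of_isMin b hj]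

/-- inverse map -/
noncomputable def phi : ((Fin d → ℕ) →₀ F) →ₗ[F] UniversalEnvelopingAlgebra F L :=
  linearCombination F (smon b)

theorem phi_mon (c : Fin d → ℕ) : phi b (mon F c) = smon b c := by simp [phi, mon]

theorem ι_lie_mul (x y : L) (u : UniversalEnvelopingAlgebra F L) :
    UniversalEnvelopingAlgebra.ι F x * (UniversalEnvelopingAlgebra.ι F y * u) =
      UniversalEnvelopingAlgebra.ι F y * (UniversalEnvelopingAlgebra.ι F x * u)
      + UniversalEnvelopingAlgebra.ι F ⁅x, y⁆ * u := by
  rw [LieHom.map_lie, LieRing.of_associative_ring_bracket]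
  noncomm_ring

theorem phi_act_mon (i : Fin d) (c : Fin d → ℕ) :
    phi b (act b i (mon F c)) = gen b i * phi b (mon F c) := by
  suffices ∀ n, ∀ i (c : Fin d → ℕ), dg c < n →
      phi b (act b i (mon F c)) = gen b i * phi b (mon F c) from
    this (dg c + 1) i c (Nat.lt_succ_self _)
  intro n
  induction n with
  | zero => intro i c h; omega
  | succ n ih =>
    intro i c hc
    by_cases hm : IsMin i c
    · rw [act_of_isMin b hm, phi_mon, phi_mon, smon_add b hm]
    have hc0 : c ≠ 0 := by rintro rfl; exact hm fun _ _ => rfl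
    obtain ⟨j, t, hj, rfl⟩ := exists_min hc0
    have hji : j < i := by
      by_contra hle
      refine hm fun k hk => ?_
      have hkj : k < j := lt_of_lt_of_le hk (not_lt.1 hle)
      simp [dl, hj k hkj, hkj.ne]
    rw [dg_add, dg_dl] at hc
    have hlow : ∀ l, ∀ w ∈ Slt F d (dg t + 1), phi b (act b l w) = gen b l * phi b w := by
      intro l w hw
      have : Slt F d (dg t + 1) ≤ LinearMap.ker
          (phi b ∘ₗ act b l - LinearMap.mulLeft F (gen b l) ∘ₗ phi b) := Slt_le fun c hc => by
        simp [ih l c (by omega)]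
      simpa [sub_eq_zero] using this hw
    have hlowL : ∀ x : L, phi b (actL b x (mon F t)) =
        UniversalEnvelopingAlgebra.ι F x * phi b (mon F t) := by
      intro x
      refine basis_ind b x ?_ ?_ ?_ ?_
      · simp
      · intro x x' hx hx'
        simp only [map_add, LinearMap.add_apply, add_mul] at *
        rw [← hx, ← hx']
      · intro a x hx
        simp only [map_smul, LinearMap.smul_apply, smul_mul_assoc] at *
        rw [← hx]
      · intro k
        rw [actL_basis]
        exact ih k t (by omega)
    have h' : IsMin j (t + dl i) := fun k hk => by
      simp [dl, hj k hk, (hk.trans hji).ne]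
    have hjj : phi b (act b j (act b i (mon F t))) = gen b j * phi b (act b i (mon F t)) := by
      have h1 := hlow j _ (act_sub_mem b i t)
      simp only [map_sub, mul_sub] at h1
      rw [act_of_isMin b h', phi_mon, phi_mon, smon_add b h', sub_left_inj] at h1
      exact h1
    rw [act_rec b hji hj, map_add, hjj, hlowL, ih i t (by omega), phi_mon, phi_mon,
      smon_add b hj]
    exact (ι_lie_mul _ _ _).symm

theorem phi_act (i : Fin d) (w : (Fin d → ℕ) →₀ F) :
    phi b (act b i w) = gen b i * phi b w := by
  have : phi b ∘ₗ act b i = LinearMap.mulLeft F (gen b i) ∘ₗ phi b := by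
    refine Finsupp.lhom_ext' fun c => LinearMap.ext_ring ?_
    exact phi_act_mon b i c
  exact LinearMap.congr_fun this w

theorem phi_actL (x : L) (w : (Fin d → ℕ) →₀ F) :
    phi b (actL b x w) = UniversalEnvelopingAlgebra.ι F x * phi b w := by
  refine basis_ind b x ?_ ?_ ?_ ?_
  · simp
  · intro x x' hx hx'
    simp only [map_add, LinearMap.add_apply, add_mul] at *
    rw [← hx, ← hx']
  · intro a x hx
    simp only [map_smul, LinearMap.smul_apply, smul_mul_assoc] at *
    rw [← hx]
  · intro k
    rw [actL_basis]
    exact phi_act b k w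

theorem U_adjoin : Algebra.adjoin F
    (Set.range (UniversalEnvelopingAlgebra.ι F : L → UniversalEnvelopingAlgebra F L)) = ⊤ := by
  have hs : Function.Surjective (UniversalEnvelopingAlgebra.mkAlgHom F L) := by
    intro x
    obtain ⟨y, rfl⟩ := Quotient.exists_rep x
    exact ⟨y, rfl⟩
  have : Set.range (UniversalEnvelopingAlgebra.ι F : L → UniversalEnvelopingAlgebra F L) =
      UniversalEnvelopingAlgebra.mkAlgHom F L '' Set.range (TensorAlgebra.ι F) := by
    rw [← Set.range_comp]; rfl
  rw [this, ← AlgHom.map_adjoin, TensorAlgebra.adjoin_range_ι, Algebra.map_top,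
    (AlgHom.range_eq_top _).2 hs]

theorem phi_rep (u : UniversalEnvelopingAlgebra F L) (w : (Fin d → ℕ) →₀ F) :
    phi b (rep b u w) = u * phi b w := by
  have hu : u ∈ Algebra.adjoin F
    (Set.range (UniversalEnvelopingAlgebra.ι F : L → UniversalEnvelopingAlgebra F L)) := by
    rw [U_adjoin]; trivial
  induction hu using Algebra.adjoin_induction generalizing w with
  | mem x hx => obtain ⟨x, rfl⟩ := hx; rw [rep_ι, phi_actL]
  | algebraMap r => simp [Algebra.algebraMap_eq_smul_one]
  | add x y _ _ hx hy => simp [hx, hy, add_mul]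
  | mul x y _ _ hx hy => simp [hx, hy, mul_assoc]

/-- PBW as a linear equivalence -/
noncomputable def pbw : UniversalEnvelopingAlgebra F L ≃ₗ[F] ((Fin d → ℕ) →₀ F) :=
  LinearEquiv.ofLinearMap ((LinearMap.applyₗ (mon F 0)) ∘ₗ (rep b).toLinearMap) (phi b)
    (by
      refine Finsupp.lhom_ext' fun c => LinearMap.ext_ring ?_
      change rep b (phi b (mon F c)) (mon F 0) = mon F c
      rw [phi_mon, rep_smon])
    (by
      refine LinearMap.ext fun u => ?_
      change phi b (rep b u (mon F 0)) = u
      rw [phi_rep, phi_mon, smon_zero, mul_one])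

theorem pbw_apply (u : UniversalEnvelopingAlgebra F L) : pbw b u = rep b u (mon F 0) := rfl

end

end PBW

namespace PBW

open Finsupp

attribute [local instance] LieRing.ofAssociativeRing

section

variable {F L : Type*} [Field F] [LieRing L] [LieAlgebra F L] {d : ℕ}

theorem exists_ppoly [FiniteDimensional F L] (p : ℕ) (x : L) : ∃ (m : ℕ) (c : ℕ → F),
    (LieAlgebra.ad F L x : Module.End F L) ^ (p ^ m) =
      ∑ k ∈ Finset.range m, c k • (LieAlgebra.ad F L x : Module.End F L) ^ (p ^ k) := by
  set f : ℕ → Module.End F L := fun k => (LieAlgebra.ad F L x : Module.End F L) ^ (p ^ k) with hf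
  let W : ℕ →o Submodule F (Module.End F L) :=
    ⟨fun n => Submodule.span F (f '' (Finset.range n : Set ℕ)), fun a b hab =>
      Submodule.span_mono (Set.image_mono (by simpa using hab))⟩
  obtain ⟨n, hn⟩ := monotone_stabilizes_iff_noetherian.2
    (inferInstance : IsNoetherian F (Module.End F L)) W
  have h1 : f n ∈ W (n + 1) := Submodule.subset_span ⟨n, by simp, rfl⟩
  rw [← hn (n + 1) (Nat.le_succ n)] at h1
  obtain ⟨c, hc⟩ := (Submodule.mem_span_image_finset_iff_exists_fun F).1 h1
  refine ⟨n, fun k => if h : k ∈ Finset.range n then c ⟨k, h⟩ else 0, hc.symm.trans ?_⟩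
  rw [← Finset.sum_coe_sort (Finset.range n)]
  exact Finset.sum_congr rfl fun k _ => by beta_reduce; rw [dif_pos k.2]

variable (b : Module.Basis (Fin d) F L)

include b in
theorem U_nontrivial : Nontrivial (UniversalEnvelopingAlgebra F L) :=
  (pbw b).toEquiv.nontrivial

theorem ad_pow_ι (x y : L) (n : ℕ) :
    ((LinearMap.mulLeft F (UniversalEnvelopingAlgebra.ι F x) -
      LinearMap.mulRight F (UniversalEnvelopingAlgebra.ι F x)) ^ n)
        (UniversalEnvelopingAlgebra.ι F y) =
      UniversalEnvelopingAlgebra.ι F (((LieAlgebra.ad F L x : Module.End F L) ^ n) y) := by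
  induction n with
  | zero => simp
  | succ n ih =>
    rw [pow_succ', pow_succ', Module.End.mul_apply, ih, Module.End.mul_apply, LieAlgebra.ad_apply,
      LieHom.map_lie, LieRing.of_associative_ring_bracket]
    rfl

include b in
theorem central_of (p : ℕ) [Fact p.Prime] [CharP F p] (x : L) (m : ℕ) (c : ℕ → F)
    (h : (LieAlgebra.ad F L x : Module.End F L) ^ (p ^ m) =
      ∑ k ∈ Finset.range m, c k • (LieAlgebra.ad F L x : Module.End F L) ^ (p ^ k))
    (u : UniversalEnvelopingAlgebra F L) :
    Commute (UniversalEnvelopingAlgebra.ι F x ^ (p ^ m) -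
      ∑ k ∈ Finset.range m, c k • UniversalEnvelopingAlgebra.ι F x ^ (p ^ k)) u := by
  have := U_nontrivial b
  have : CharP (Module.End F (UniversalEnvelopingAlgebra F L)) p :=
    charP_of_injective_algebraMap
      (algebraMap F (Module.End F (UniversalEnvelopingAlgebra F L))).injective p
  set e := UniversalEnvelopingAlgebra.ι F x with he
  have key : ∀ k (y : L), e ^ (p ^ k) * UniversalEnvelopingAlgebra.ι F y
      - UniversalEnvelopingAlgebra.ι F y * e ^ (p ^ k) =
      UniversalEnvelopingAlgebra.ι F (((LieAlgebra.ad F L x : Module.End F L) ^ (p ^ k)) y) := by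
    intro k y
    rw [← ad_pow_ι, ← he, sub_pow_char_pow_of_commute _ _ (LinearMap.commute_mulLeft_right _ _),
      LinearMap.pow_mulLeft, LinearMap.pow_mulRight]
    rfl
  have hu : u ∈ Algebra.adjoin F
    (Set.range (UniversalEnvelopingAlgebra.ι F : L → UniversalEnvelopingAlgebra F L)) := by
    rw [U_adjoin]; trivial
  induction hu using Algebra.adjoin_induction with
  | mem u hu =>
    obtain ⟨y, rfl⟩ := hu
    rw [Commute, SemiconjBy, ← sub_eq_zero]
    have h1 := key m y
    rw [h] at h1
    simp only [LinearMap.sum_apply, map_sum, LinearMap.smul_apply, map_smul, ← key] at h1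
    simp only [sub_mul, mul_sub, Finset.sum_mul, Finset.mul_sum, smul_mul_assoc, mul_smul_comm]
    simp only [smul_sub, Finset.sum_sub_distrib] at h1
    rw [sub_sub_sub_comm, h1, sub_self]
  | algebraMap r => exact (Algebra.commutes r _).symm
  | add x y _ _ hx hy => exact hx.add_right hy
  | mul x y _ _ hx hy => exact hx.mul_right hy

/-- leading term -/
def LT (w : (Fin d → ℕ) →₀ F) (c : Fin d → ℕ) : Prop := w - mon F c ∈ Slt F d (dg c)

theorem LT.mem {w : (Fin d → ℕ) →₀ F} {c : Fin d → ℕ} (h : LT w c) : w ∈ Slt F d (dg c + 1) := by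
  have := add_mem (Slt_mono (Nat.le_succ _) h) (mon_mem (F := F) (Nat.lt_succ_self (dg c)))
  simpa using this

theorem LT.act {w : (Fin d → ℕ) →₀ F} {c : Fin d → ℕ} (h : LT w c) (i : Fin d) :
    LT (act b i w) (c + dl i) := by
  have h1 := add_mem (act_mem b _ i h) (act_sub_mem b i c)
  rw [map_sub, sub_add_sub_cancel] at h1
  rw [LT, dg_add, dg_dl]
  exact h1

theorem LT.act_pow {w : (Fin d → ℕ) →₀ F} {c : Fin d → ℕ} (h : LT w c) (i : Fin d) (k : ℕ) :
    LT ((PBW.act b i ^ k) w) (c + k • dl i) := by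
  induction k with
  | zero => simpa using h
  | succ k ih =>
    rw [pow_succ', Module.End.mul_apply, succ_nsmul, ← add_assoc]
    exact ih.act b i

theorem act_pow_mem (n : ℕ) (i : Fin d) {w : (Fin d → ℕ) →₀ F} (hw : w ∈ Slt F d n) (k : ℕ) :
    (act b i ^ k) w ∈ Slt F d (n + k) := by
  induction k with
  | zero => simpa using hw
  | succ k ih =>
    rw [pow_succ', Module.End.mul_apply]
    exact act_mem b _ i ih

theorem dg_nsmul (k : ℕ) (c : Fin d → ℕ) : dg (k • c) = k * dg c := by
  simp [dg, Finset.mul_sum]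

theorem exists_central [FiniteDimensional F L] (p : ℕ) [Fact p.Prime] [CharP F p] (i : Fin d) :
    ∃ (q : ℕ) (z : Subring.center (UniversalEnvelopingAlgebra F L)), q ≠ 0 ∧
      ∀ (w : (Fin d → ℕ) →₀ F) (c : Fin d → ℕ), LT w c →
        LT (rep b (z : UniversalEnvelopingAlgebra F L) w) (c + q • dl i) := by
  obtain ⟨m, c, h⟩ := exists_ppoly (F := F) p (b i)
  have hp : p.Prime := Fact.out
  refine ⟨p ^ m, ⟨gen b i ^ (p ^ m) - ∑ k ∈ Finset.range m, c k • gen b i ^ (p ^ k),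
    Subring.mem_center_iff.2 fun u => (central_of b p (b i) m c h u).eq.symm⟩,
    pow_ne_zero _ hp.ne_zero, ?_⟩
  intro w t hw
  have h1 := hw.act_pow b i (p ^ m)
  simp only [map_sub, map_pow, rep_gen, map_sum, map_smul, LinearMap.sub_apply,
    LinearMap.sum_apply, LinearMap.smul_apply]
  rw [LT, sub_right_comm]
  refine sub_mem h1 (sum_mem fun k hk => Submodule.smul_mem _ _ ?_)
  refine Slt_mono ?_ (act_pow_mem b _ i hw.mem (p ^ k))
  rw [dg_add, dg_nsmul, dg_dl]
  have : p ^ k < p ^ m := Nat.pow_lt_pow_right hp.one_lt (Finset.mem_range.1 hk)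
  omega

/-- triangular change of basis -/
theorem bij_of_LT (w : (Fin d → ℕ) → ((Fin d → ℕ) →₀ F)) (hw : ∀ c, LT (w c) c) :
    Function.Bijective (linearCombination F w) := by
  set T := linearCombination F w with hT
  have hTm : ∀ c, T (mon F c) = w c := fun c => by simp [T, mon]
  have hlow : ∀ n, ∀ x ∈ Slt F d (n + 1), T x - x ∈ Slt F d n := by
    intro n x hx
    have : Slt F d (n + 1) ≤ (Slt F d n).comap (T - LinearMap.id) := Slt_le fun c hc => by
      have := Slt_mono (Nat.lt_succ_iff.1 hc) (hw c)
      simpa [hTm] using this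
    exact this hx
  have hbd : ∀ x : (Fin d → ℕ) →₀ F, ∃ n, x ∈ Slt F d n := by
    intro x
    refine ⟨x.support.sup dg + 1, ?_⟩
    rw [Slt, Finsupp.mem_supported]
    intro c hc
    exact Nat.lt_succ_iff.2 (Finset.le_sup (f := dg) hc)
  have h0 : ∀ x ∈ Slt F d 0, x = 0 := by
    intro x hx
    rw [Slt, Finsupp.mem_supported] at hx
    simpa using hx
  constructor
  · rw [← LinearMap.ker_eq_bot, eq_bot_iff]
    intro x hx
    obtain ⟨n, hn⟩ := hbd x
    rw [LinearMap.mem_ker] at hx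
    induction n with
    | zero => exact h0 x hn
    | succ n ih =>
      have := hlow n x hn
      rw [hx, zero_sub] at this
      exact ih (neg_mem_iff.1 this)
  · intro x
    obtain ⟨n, hn⟩ := hbd x
    induction n generalizing x with
    | zero => exact ⟨0, by rw [h0 x hn, map_zero]⟩
    | succ n ih =>
      obtain ⟨y, hy⟩ := ih _ (hlow n x hn)
      exact ⟨x - y, by rw [map_sub, hy]; abel⟩

theorem LT_prod (q : Fin d → ℕ) (z : Fin d → Subring.center (UniversalEnvelopingAlgebra F L))
    (hz : ∀ i (w : (Fin d → ℕ) →₀ F) (c : Fin d → ℕ), LT w c →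
        LT (rep b (z i : UniversalEnvelopingAlgebra F L) w) (c + q i • dl i))
    (t : Fin d → ℕ) (s : Finset (Fin d)) (w : (Fin d → ℕ) →₀ F) (c : Fin d → ℕ) (h : LT w c) :
    LT (rep b ((∏ i ∈ s, z i ^ t i : Subring.center (UniversalEnvelopingAlgebra F L)) :
      UniversalEnvelopingAlgebra F L) w) (c + ∑ i ∈ s, t i • q i • dl i) := by
  classical
  have hpow : ∀ i k (w : (Fin d → ℕ) →₀ F) (c : Fin d → ℕ), LT w c →
        LT (rep b ((z i ^ k : Subring.center (UniversalEnvelopingAlgebra F L)) :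
          UniversalEnvelopingAlgebra F L) w) (c + k • q i • dl i) := by
    intro i k w c h
    induction k with
    | zero => simpa using h
    | succ k ih =>
      rw [pow_succ', Subring.coe_mul, map_mul, Module.End.mul_apply, succ_nsmul, ← add_assoc]
      exact hz i _ _ ih
  induction s using Finset.induction_on with
  | empty => simpa using h
  | insert i s hi ih =>
    rw [Finset.prod_insert hi, Finset.sum_insert hi, Subring.coe_mul, map_mul,
      Module.End.mul_apply, add_comm (t i • q i • dl i), ← add_assoc]
    exact hpow i _ _ _ ih

/-- mixed radix equivalence -/
def radix (q : Fin d → ℕ) [∀ i, NeZero (q i)] :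
    ((Fin d → ℕ) × (∀ i, Fin (q i))) ≃ (Fin d → ℕ) where
  toFun x i := q i * x.1 i + x.2 i
  invFun c := (fun i => c i / q i, fun i => ⟨c i % q i, Nat.mod_lt _ (NeZero.pos _)⟩)
  left_inv x := by
    refine Prod.ext (funext fun i => ?_) (funext fun i => Fin.ext ?_)
    · simp [Nat.mul_add_div (NeZero.pos (q i)), Nat.div_eq_of_lt (x.2 i).2]
    · simp [Nat.mod_eq_of_lt (x.2 i).2]
  right_inv c := funext fun i => Nat.div_add_mod _ _

include b in
theorem exists_basis [FiniteDimensional F L] (p : ℕ) [Fact p.Prime] [CharP F p] :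
    ∃ (q : Fin d → ℕ) (z : Fin d → Subring.center (UniversalEnvelopingAlgebra F L))
      (v : Module.Basis ((Fin d → ℕ) × (∀ i, Fin (q i))) F (UniversalEnvelopingAlgebra F L)),
      (∀ i, q i ≠ 0) ∧ ∀ i t a, (z i : UniversalEnvelopingAlgebra F L) * v (t, a) =
        v (t + Pi.single i 1, a) := by
  choose q z hq hz using fun i => exists_central b p i
  have : ∀ i, NeZero (q i) := fun i => ⟨hq i⟩
  let v0 : (Fin d → ℕ) × (∀ i, Fin (q i)) → UniversalEnvelopingAlgebra F L := fun x =>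
    ((∏ i, z i ^ x.1 i : Subring.center (UniversalEnvelopingAlgebra F L)) :
      UniversalEnvelopingAlgebra F L) * smon b (fun i => x.2 i)
  have hv0 : ∀ x, LT (pbw b (v0 x)) (radix q x) := by
    rintro ⟨t, a⟩
    have h := LT_prod b q z hz t Finset.univ (mon F fun i => (a i : ℕ)) (fun i => (a i : ℕ))
      (by rw [LT, sub_self]; exact zero_mem _)
    rw [pbw_apply, map_mul, Module.End.mul_apply, rep_smon]
    convert h using 1
    funext j
    simp [radix, dl, Finset.sum_apply, Pi.single_apply, add_comm, mul_comm]
  have hbij := bij_of_LT (fun c => pbw b (v0 ((radix q).symm c))) (fun c => by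
    have := hv0 ((radix q).symm c)
    rwa [Equiv.apply_symm_apply] at this)
  let B : Module.Basis ((Fin d → ℕ) × (∀ i, Fin (q i))) F (UniversalEnvelopingAlgebra F L) :=
    ((Module.Basis.ofRepr ((LinearEquiv.ofBijective _ hbij).symm)).map (pbw b).symm).reindex
      (radix q).symm
  have hB : ∀ x, B x = v0 x := by
    intro x
    simp [B]
  refine ⟨q, z, B, hq, fun i t a => ?_⟩
  rw [hB, hB, ← mul_assoc, ← Subring.coe_mul]
  congr 2
  simp only [Pi.add_apply, pow_add, Finset.prod_mul_distrib]
  rw [mul_comm]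
  congr 1
  simp [Pi.single_apply]

end

end PBW

namespace PBW

universe w

/-- the F-dual of R, a left R-module -/
def DualU (F R : Type w) [Field F] [Ring R] [Algebra F R] : Type w := R →ₗ[F] F

section

variable {F R : Type w} [Field F] [Ring R] [Algebra F R]

noncomputable instance : AddCommGroup (DualU F R) := inferInstanceAs (AddCommGroup (R →ₗ[F] F))
noncomputable instance : Module F (DualU F R) := inferInstanceAs (Module F (R →ₗ[F] F))

/-- evaluation -/
def DualU.ev (f : DualU F R) (x : R) : F := (show R →ₗ[F] F from f) x

theorem DualU.ext {f g : DualU F R} (h : ∀ x, f.ev x = g.ev x) : f = g := LinearMap.ext h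

noncomputable instance : Module R (DualU F R) where
  smul u f := (show R →ₗ[F] F from f) ∘ₗ LinearMap.mulRight F u
  one_smul f := DualU.ext fun x => congrArg f.ev (mul_one x)
  mul_smul u u' f := DualU.ext fun x => congrArg f.ev (mul_assoc x u u').symm
  smul_zero u := rfl
  zero_smul f := DualU.ext fun x => (congrArg f.ev (mul_zero x)).trans (map_zero _)
  smul_add u f g := rfl
  add_smul u u' f := DualU.ext fun x => (congrArg f.ev (mul_add x u u')).trans (map_add _ _ _)

theorem DualU.ev_smul (u : R) (f : DualU F R) (x : R) : (u • f).ev x = f.ev (x * u) := rfl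
theorem DualU.ev_fsmul (c : F) (f : DualU F R) (x : R) : (c • f).ev x = c * f.ev x := rfl
theorem DualU.ev_add (f g : DualU F R) (x : R) : (f + g).ev x = f.ev x + g.ev x := rfl
theorem DualU.ev_zero (x : R) : (0 : DualU F R).ev x = 0 := rfl

instance : IsScalarTower F R (DualU F R) where
  smul_assoc c u f := DualU.ext fun x => by
    rw [DualU.ev_fsmul, DualU.ev_smul, DualU.ev_smul, mul_smul_comm]
    exact map_smul (show R →ₗ[F] F from f) _ _

variable {d : ℕ} (z : Fin d → Subring.center R)

theorem zcomm (i : Fin d) (n : ℕ) (u : R) : (z i : R) ^ n * u = u * (z i : R) ^ n := by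
  have := Subring.mem_center_iff.1 (z i ^ n).2 u
  simpa using this.symm

variable (F) in
/-- the modules N_r -/
def Nsub (r : ℕ) : Submodule R (DualU F R) where
  carrier := {f | (∀ i, ∃ n, (z i : R) ^ n • f = 0) ∧ ∀ i : Fin d, i.val < r → (z i : R) • f = 0}
  zero_mem' := ⟨fun i => ⟨0, smul_zero _⟩, fun i _ => smul_zero _⟩
  add_mem' := by
    rintro f g ⟨hf, hf'⟩ ⟨hg, hg'⟩
    refine ⟨fun i => ?_, fun i hi => by rw [smul_add, hf' i hi, hg' i hi, add_zero]⟩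
    obtain ⟨n, hn⟩ := hf i
    obtain ⟨m, hm⟩ := hg i
    refine ⟨n + m, ?_⟩
    rw [smul_add, pow_add, mul_smul _ _ g, hm, smul_zero, add_zero, ← pow_add, add_comm n m,
      pow_add, mul_smul, hn, smul_zero]
  smul_mem' := by
    rintro u f ⟨hf, hf'⟩
    refine ⟨fun i => ?_, fun i hi => ?_⟩
    · obtain ⟨n, hn⟩ := hf i
      exact ⟨n, by rw [← mul_smul, zcomm, mul_smul, hn, smul_zero]⟩
    · have := zcomm z i 1 u
      rw [pow_one] at this
      rw [← mul_smul, this, mul_smul, hf' i hi, smul_zero]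

variable {κ : Type} (v : Module.Basis ((Fin d → ℕ) × κ) F R)
  (hv : ∀ i t a, (z i : R) * v (t, a) = v (t + Pi.single i 1, a))

include hv

theorem hvn (i : Fin d) (n : ℕ) (t : Fin d → ℕ) (a : κ) :
    (z i : R) ^ n * v (t, a) = v (t + Pi.single i n, a) := by
  induction n with
  | zero => simp
  | succ n ih => rw [pow_succ', mul_assoc, ih, hv, add_assoc, ← Pi.single_add]

omit hv in
theorem dual_ext {f g : DualU F R} (h : ∀ t a, f.ev (v (t, a)) = g.ev (v (t, a))) : f = g :=
  v.ext fun x => h x.1 x.2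

theorem ev_zpow (i : Fin d) (n : ℕ) (f : DualU F R) (t : Fin d → ℕ) (a : κ) :
    ((z i : R) ^ n • f).ev (v (t, a)) = f.ev (v (t + Pi.single i n, a)) := by
  rw [DualU.ev_smul, ← zcomm, hvn z v hv]

theorem Nsub_surj (r : Fin d) (f : DualU F R) (hf : f ∈ Nsub F z r) :
    ∃ g ∈ Nsub F z r, (z r : R) • g = f := by
  classical
  let g0 : R →ₗ[F] F := v.constr F fun x =>
    if x.1 r = 0 then 0 else f.ev (v (x.1 - Pi.single r 1, x.2))
  let g : DualU F R := g0
  have hg : ∀ t a, g.ev (v (t, a)) = if t r = 0 then 0 else f.ev (v (t - Pi.single r 1, a)) := by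
    intro t a
    change g0 (v (t, a)) = _
    simp [g0]
  have h1 : (z r : R) • g = f := by
    refine dual_ext v fun t a => ?_
    have := ev_zpow z v hv r 1 g t a
    rw [pow_one] at this
    rw [this, hg, if_neg (by simp), add_tsub_cancel_right]
  have h2 : ∀ i, i ≠ r → ∀ n, (z i : R) ^ n • f = 0 → (z i : R) ^ n • g = 0 := by
    intro i hi n hn
    refine dual_ext v fun t a => ?_
    rw [ev_zpow z v hv, hg, DualU.ev_zero]
    split_ifs with h0
    · rfl
    · have : t + Pi.single i n - Pi.single r 1 = (t - Pi.single r 1) + Pi.single i n := by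
        funext j
        by_cases hj : j = i
        · subst hj; simp [hi]
        · simp [hj]
      rw [this, ← ev_zpow z v hv, hn, DualU.ev_zero]
  refine ⟨g, ⟨fun i => ?_, fun i hi => ?_⟩, h1⟩
  · obtain ⟨n, hn⟩ := hf.1 i
    by_cases hi : i = r
    · subst hi
      exact ⟨n + 1, by rw [pow_succ, mul_smul, h1, hn]⟩
    · exact ⟨n, h2 i hi n hn⟩
  · have := h2 i (by rintro rfl; omega) 1 (by rw [pow_one]; exact hf.2 i hi)
    rwa [pow_one] at this

theorem Nsub_ne [Nonempty κ] : ∃ f ∈ Nsub F z d, f ≠ 0 := by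
  classical
  let g0 : R →ₗ[F] F := v.constr F fun x => if x.1 = 0 then 1 else 0
  let g : DualU F R := g0
  have hg : ∀ t a, g.ev (v (t, a)) = if t = 0 then 1 else 0 := by
    intro t a
    change g0 (v (t, a)) = _
    simp [g0]
  have h : ∀ i, (z i : R) ^ 1 • g = 0 := by
    intro i
    refine dual_ext v fun t a => ?_
    rw [ev_zpow z v hv, hg, if_neg, DualU.ev_zero]
    intro h
    have := congrFun h i
    simp at this
  refine ⟨g, ⟨fun i => ⟨1, h i⟩, fun i _ => by simpa using h i⟩, fun h0 => ?_⟩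
  have := hg 0 (Classical.arbitrary κ)
  rw [h0, if_pos rfl, DualU.ev_zero] at this
  exact zero_ne_one this

theorem locfin [Finite κ] {M : Type*} [AddCommGroup M] [Module R M] [Module F M]
    [IsScalarTower F R M] (m : M) (hm : ∀ i, ∃ n, (z i : R) ^ n • m = 0) :
    Module.Finite F ((Submodule.span R {m}).restrictScalars F) := by
  choose n hn using hm
  let B : Set M := (fun x : (Fin d → ℕ) × κ => v x • m) '' (Set.Icc 0 n ×ˢ Set.univ)
  have hB : B.Finite := ((Set.finite_Icc 0 n).prod Set.finite_univ).image _
  have hle : (Submodule.span R {m}).restrictScalars F ≤ Submodule.span F B := by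
    intro x hx
    obtain ⟨u, rfl⟩ := Submodule.mem_span_singleton.1 hx
    have hu : u ∈ Submodule.span F (Set.range v) := by rw [v.span_eq]; trivial
    clear hx
    induction hu using Submodule.span_induction with
    | mem u h =>
      obtain ⟨⟨t, a⟩, rfl⟩ := h
      by_cases ht : t ≤ n
      · exact Submodule.subset_span ⟨(t, a), ⟨⟨fun i => Nat.zero_le _, ht⟩, trivial⟩, rfl⟩
      · obtain ⟨i, hi⟩ := not_forall.1 ht
        have hi' : n i < t i := not_le.1 hi
        have : t = (t - Pi.single i (n i)) + Pi.single i (n i) := by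
          funext j
          by_cases hj : j = i
          · subst hj; simp; omega
          · simp [hj]
        rw [this, ← hvn z v hv, zcomm, mul_smul, hn, smul_zero]
        exact zero_mem _
    | zero => rw [zero_smul]; exact zero_mem _
    | add x y _ _ hx hy => rw [add_smul]; exact add_mem hx hy
    | smul a x _ hx => rw [smul_assoc]; exact Submodule.smul_mem _ _ hx
  have := FiniteDimensional.span_of_finite F hB
  exact Submodule.finiteDimensional_of_le hle

omit hv in
theorem exists_extend_zero {V : Type*} [AddCommGroup V] [Module F V] (I W : Submodule F V)
    (l : I →ₗ[F] F) (h : ∀ x : I, (x : V) ∈ W → l x = 0) :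
    ∃ g : V →ₗ[F] F, (∀ x : I, g x = l x) ∧ ∀ x ∈ W, g x = 0 := by
  let j : I →ₗ[F] V ⧸ W := W.mkQ ∘ₗ I.subtype
  have hj : LinearMap.ker j ≤ LinearMap.ker l := fun x hx => h x (by simpa [j] using hx)
  let l' : LinearMap.range j →ₗ[F] F :=
    (LinearMap.ker j).liftQ l hj ∘ₗ j.quotKerEquivRange.symm.toLinearMap
  obtain ⟨g, hg⟩ := LinearMap.exists_extend l'
  refine ⟨g ∘ₗ W.mkQ, fun x => ?_, fun x hx => ?_⟩
  · have h1 := LinearMap.congr_fun hg ⟨j x, LinearMap.mem_range_self j x⟩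
    have h2 : j.quotKerEquivRange.symm ⟨j x, LinearMap.mem_range_self j x⟩ =
        (LinearMap.ker j).mkQ x := by
      rw [LinearEquiv.symm_apply_eq]; rfl
    simp only [LinearMap.comp_apply, l', LinearEquiv.coe_coe, h2] at h1
    exact h1.trans (by simp)
  · have : W.mkQ x = 0 := by simpa using hx
    rw [LinearMap.comp_apply, this, map_zero]

theorem Nsub_baer [Finite κ] : Module.Baer R (Nsub F z 0) := by
  classical
  let φ : F →+* Subring.center R := (algebraMap F R).codRestrict (Subring.center R)
    (fun c => Subring.mem_center_iff.2 fun u => (Algebra.commutes c u).symm)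
  let ψ : MvPolynomial (Fin d) F →+* R :=
    (Subring.center R).subtype.comp (MvPolynomial.eval₂Hom φ z)
  letI : Module (MvPolynomial (Fin d) F) R := Module.compHom R ψ
  have hsm : ∀ (a : MvPolynomial (Fin d) F) (x : R), a • x = ψ a * x := fun a x => rfl
  have hX : ∀ i, ψ (MvPolynomial.X i) = z i := fun i => by simp [ψ]
  have hC : ∀ c, ψ (MvPolynomial.C c) = algebraMap F R c := fun c => by simp [ψ, φ]
  have hψc : ∀ a u, ψ a * u = u * ψ a := fun a u =>
    (Subring.mem_center_iff.1 (MvPolynomial.eval₂Hom φ z a).2 u).symm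
  haveI : IsScalarTower F (MvPolynomial (Fin d) F) R := ⟨fun c a x => by
    rw [hsm, hsm, MvPolynomial.smul_eq_C_mul, map_mul, hC, mul_assoc, Algebra.smul_def]⟩
  haveI : IsScalarTower (MvPolynomial (Fin d) F) R R := ⟨fun a x y => by
    rw [hsm, smul_eq_mul, smul_eq_mul, hsm, mul_assoc]⟩
  have hfin : Module.Finite (MvPolynomial (Fin d) F) R := by
    refine ⟨Submodule.fg_def.2 ⟨Set.range fun a : κ => v (0, a), Set.finite_range _, ?_⟩⟩
    rw [eq_top_iff]
    intro x _
    have hx : x ∈ Submodule.span F (Set.range v) := by rw [v.span_eq]; trivial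
    suffices hle : Submodule.span F (Set.range v) ≤ (Submodule.span (MvPolynomial (Fin d) F)
        (Set.range fun a : κ => v (0, a))).restrictScalars F from hle hx
    refine Submodule.span_le.2 ?_
    rintro _ ⟨⟨t, a⟩, rfl⟩
    induction hn : dg t generalizing t with
    | zero =>
      have : t = 0 := by
        by_contra h
        obtain ⟨j, t, -, rfl⟩ := exists_min h
        rw [dg_add, dg_dl] at hn; omega
      subst this
      exact Submodule.subset_span ⟨a, rfl⟩
    | succ n ih =>
      have h : t ≠ 0 := by rintro rfl; rw [dg_zero] at hn; omega
      obtain ⟨j, t, hj, rfl⟩ := exists_min h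
      rw [dg_add, dg_dl] at hn
      have h1 := Submodule.smul_mem _ (MvPolynomial.X j) (ih t (by omega))
      rw [hsm, hX, hv] at h1
      exact h1
  have hnoeA : IsNoetherian (MvPolynomial (Fin d) F) R := inferInstance
  have hnoe : IsNoetherianRing R := isNoetherian_of_tower (MvPolynomial (Fin d) F) hnoeA
  intro I g
  -- uniform exponent
  obtain ⟨n, hn⟩ : ∃ n, ∀ (x : I) i, (z i : R) ^ n • g x = 0 := by
    obtain ⟨S, hS⟩ : (⊤ : Submodule R I).FG := Module.Finite.fg_top
    choose e he using fun (x : I) => (g x).2.1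
    let n := S.sup fun s => Finset.univ.sup (e s)
    refine ⟨n, fun x i => ?_⟩
    have hx : x ∈ Submodule.span R (S : Set I) := by rw [hS]; trivial
    induction hx using Submodule.span_induction with
    | mem s hs =>
      have h1 : e s i ≤ n := (Finset.le_sup (f := e s) (Finset.mem_univ i)).trans
        (Finset.le_sup (f := fun s => Finset.univ.sup (e s)) hs)
      rw [← Nat.sub_add_cancel h1, pow_add, mul_smul]
      have : (z i : R) ^ e s i • g s = 0 := Subtype.ext (he s i)
      rw [this, smul_zero]
    | zero => rw [map_zero, smul_zero]
    | add x y _ _ hx hy => rw [map_add, smul_add, hx, hy, add_zero]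
    | smul a x _ hx => rw [map_smul, ← mul_smul, zcomm, mul_smul, hx, smul_zero]
  let IA : Submodule (MvPolynomial (Fin d) F) R :=
    { carrier := I
      zero_mem' := I.zero_mem
      add_mem' := I.add_mem
      smul_mem' := fun a x hx => I.smul_mem (ψ a) hx }
  let K : Submodule (MvPolynomial (Fin d) F) R :=
    { carrier := {x | ∃ h : x ∈ I, g ⟨x, h⟩ = 0}
      zero_mem' := ⟨I.zero_mem, map_zero g⟩
      add_mem' := by
        rintro x y ⟨hx, hx'⟩ ⟨hy, hy'⟩
        refine ⟨I.add_mem hx hy, ?_⟩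
        have := map_add g ⟨x, hx⟩ ⟨y, hy⟩
        rw [hx', hy', add_zero] at this
        exact this
      smul_mem' := by
        rintro a x ⟨hx, hx'⟩
        refine ⟨I.smul_mem (ψ a) hx, ?_⟩
        have := map_smul g (ψ a) ⟨x, hx⟩
        rw [hx', smul_zero] at this
        exact this }
  let m : Ideal (MvPolynomial (Fin d) F) := Ideal.span (Set.range MvPolynomial.X)
  let J : Ideal (MvPolynomial (Fin d) F) :=
    Ideal.span (Set.range fun i => (MvPolynomial.X i) ^ n)
  have hJK : J • IA ≤ K := by
    refine Submodule.smul_le.2 fun j hj y hy => ?_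
    induction hj using Submodule.span_induction with
    | mem j h =>
      obtain ⟨i, rfl⟩ := h
      refine ⟨IA.smul_mem _ hy, ?_⟩
      have h1 := map_smul g ((z i : R) ^ n) ⟨y, hy⟩
      rw [hn] at h1
      rw [← h1]
      congr 1
      refine Subtype.ext ?_
      change ψ (MvPolynomial.X i ^ n) * y = (z i : R) ^ n * y
      rw [map_pow, hX]
    | zero => rw [zero_smul]; exact zero_mem _
    | add x y _ _ hx hy => rw [add_smul]; exact add_mem hx hy
    | smul a x _ hx => rw [smul_assoc]; exact Submodule.smul_mem _ _ hx
  obtain ⟨M, hM⟩ : ∃ M, m ^ M ≤ J := by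
    refine Ideal.exists_pow_le_of_le_radical_of_fg ?_ (IsNoetherian.noetherian m)
    refine Ideal.span_le.2 ?_
    rintro _ ⟨i, rfl⟩
    exact ⟨n, Ideal.subset_span ⟨i, rfl⟩⟩
  obtain ⟨k, hk⟩ := Ideal.exists_pow_inf_eq_pow_smul m IA
  have hAR : m ^ (k + M) • (⊤ : Submodule (MvPolynomial (Fin d) F) R) ⊓ IA ≤ K := by
    rw [hk (k + M) (Nat.le_add_right _ _), Nat.add_sub_cancel_left]
    exact (Submodule.smul_mono hM inf_le_right).trans hJK
  let l : (I.restrictScalars F) →ₗ[F] F :=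
    { toFun := fun x => (g x).1.ev 1
      map_add' := fun x y => by
        have := map_add g x y
        exact congrArg (fun f => f.1.ev 1) this
      map_smul' := fun c x => by
        have h1 := map_smul g (algebraMap F R c) (⟨x.1, x.2⟩ : I)
        have h2 : (c • x.1 : R) ∈ I := (c • x).2
        have h3 : (⟨c • x.1, h2⟩ : I) = algebraMap F R c • (⟨x.1, x.2⟩ : I) :=
          Subtype.ext (Algebra.smul_def c (x : R))
        have h4 : g ⟨c • x.1, h2⟩ = algebraMap F R c • g ⟨x.1, x.2⟩ := by rw [h3, h1]
        refine (congrArg (fun f => f.1.ev 1) h4).trans ?_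
        change (algebraMap F R c • (g ⟨x.1, x.2⟩).1).ev 1 = c * (g ⟨x.1, x.2⟩).1.ev 1
        rw [algebraMap_smul, DualU.ev_fsmul] }
  obtain ⟨G, hG1, hG2⟩ := exists_extend_zero (I.restrictScalars F)
    ((m ^ (k + M) • (⊤ : Submodule (MvPolynomial (Fin d) F) R)).restrictScalars F) l (by
      rintro ⟨x, hx⟩ hx'
      obtain ⟨h1, h2⟩ := hAR ⟨hx', hx⟩
      change (g ⟨x, h1⟩).1.ev 1 = 0
      rw [h2]; rfl)
  let h : DualU F R := G
  have hh : h ∈ Nsub F z 0 := by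
    refine ⟨fun i => ⟨k + M, DualU.ext fun x => ?_⟩, fun i hi => absurd hi (Nat.not_lt_zero _)⟩
    rw [DualU.ev_smul, ← zcomm]
    refine hG2 _ ?_
    have := Submodule.smul_mem_smul (N := (⊤ : Submodule (MvPolynomial (Fin d) F) R))
      (Ideal.pow_mem_pow (Ideal.subset_span ⟨i, rfl⟩ : MvPolynomial.X i ∈ m) (k + M))
      (Submodule.mem_top (x := x))
    rw [hsm, map_pow, hX] at this
    exact this
  refine ⟨LinearMap.toSpanSingleton R _ ⟨h, hh⟩, fun x hx => ?_⟩
  refine Subtype.ext (DualU.ext fun u => ?_)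
  change G (u * x) = (g ⟨x, hx⟩).1.ev u
  have h1 := hG1 ⟨u * x, I.smul_mem u hx⟩
  have h2 := map_smul g u ⟨x, hx⟩
  refine h1.trans ?_
  have h3 : (g (u • ⟨x, hx⟩)).1.ev 1 = (g ⟨x, hx⟩).1.ev (1 * u) := by rw [h2]; rfl
  rw [one_mul] at h3
  exact h3

end

end PBW

namespace PBW

section hom

variable {F R : Type u} [Field F] [Ring R] [Algebra F R]

/-- vanishing of the n-th cohomology of Hom(P, M) -/
def Van {X : ModuleCat.{u} R} (P : ProjectiveResolution X) (M : ModuleCat.{u} R) (n : ℕ) : Prop :=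
  ∀ f : P.complex.X n ⟶ M, P.complex.d (n + 1) n ≫ f = 0 →
      ∃ g : P.complex.X (n - 1) ⟶ M, P.complex.d n (n - 1) ≫ g = f

theorem ext_iff {X : ModuleCat.{u} R} (P : ProjectiveResolution X) (M : ModuleCat.{u} R) (n : ℕ) :
    Subsingleton (ExtGrp F R X M n) ↔ Van P M n := by
  have e := P.isoExt (R := F) n M
  have h1 : Subsingleton (ExtGrp F R X M n) ↔ (P.complex.linearYonedaObj F M).ExactAt n := by
    rw [HomologicalComplex.exactAt_iff_isZero_homology, ModuleCat.isZero_iff_subsingleton]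
    exact e.toLinearEquiv.toEquiv.subsingleton_congr
  rw [h1, HomologicalComplex.exactAt_iff' _ (n - 1) n (n + 1)
    (by cases n <;> simp) (by simp), ShortComplex.moduleCat_exact_iff]
  rfl

theorem van_inj {X : ModuleCat.{u} R} (P : ProjectiveResolution X) (M : ModuleCat.{u} R)
    [Injective M] (n : ℕ) : Van P M (n + 1) := fun f hf =>
  ⟨(P.exact_succ n).descToInjective f hf, (P.exact_succ n).comp_descToInjective f hf⟩

theorem van_up {X : ModuleCat.{u} R} (P : ProjectiveResolution X)
    {S : ShortComplex (ModuleCat.{u} R)} (hS : S.ShortExact) (n : ℕ)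
    (h2 : Van P S.X₂ (n + 1)) (h3 : Van P S.X₃ n) : Van P S.X₁ (n + 1) := by
  intro f hf
  have := hS.mono_f
  have := hS.epi_g
  obtain ⟨g, hg⟩ : ∃ g : P.complex.X n ⟶ S.X₂, P.complex.d (n + 1) n ≫ g = f ≫ S.f := h2 (f ≫ S.f) (by rw [← Category.assoc, hf, Limits.zero_comp])
  obtain ⟨h, hh⟩ := h3 (g ≫ S.g) (by
    rw [← Category.assoc, hg, Category.assoc, S.zero, Limits.comp_zero])
  let h' := Projective.factorThru h S.g
  have hh' : h' ≫ S.g = h := Projective.factorThru_comp h S.g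
  have hk : (g - P.complex.d n (n - 1) ≫ h') ≫ S.g = 0 := by
    rw [Preadditive.sub_comp, Category.assoc, hh', hh, sub_self]
  refine ⟨hS.exact.lift _ hk, ?_⟩
  rw [← cancel_mono S.f, Category.assoc, hS.exact.lift_f]
  change P.complex.d (n + 1) n ≫ _ = _
  rw [Preadditive.comp_sub, hg, ← Category.assoc, P.complex.d_comp_d, Limits.zero_comp, sub_zero]

theorem van_low {X : ModuleCat.{u} R} (P : ProjectiveResolution X)
    {S : ShortComplex (ModuleCat.{u} R)} (hS : S.ShortExact) (n : ℕ)
    (ζ : P.complex ⟶ P.complex) (h0 : Homotopy ζ 0)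
    (e : S.X₃ ⟶ S.X₂)
    (hζ : ∀ c : P.complex.X n ⟶ S.X₂, ζ.f n ≫ c = c ≫ S.g ≫ e)
    (hn : ¬ Van P S.X₃ n) (he : IsIso e) : ¬ Van P S.X₁ (n + 1) := by
  intro hV
  refine hn fun f hf => ?_
  have := hS.mono_f
  have := hS.epi_g
  let f' := Projective.factorThru f S.g
  have hf' : f' ≫ S.g = f := Projective.factorThru_comp f S.g
  have hk : (P.complex.d (n + 1) n ≫ f') ≫ S.g = 0 := by rw [Category.assoc, hf', hf]
  obtain ⟨c, hc⟩ : ∃ c : P.complex.X n ⟶ S.X₁, P.complex.d (n + 1) n ≫ c =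
      hS.exact.lift _ hk := hV (hS.exact.lift _ hk) (by
    rw [← cancel_mono S.f, Category.assoc, hS.exact.lift_f, ← Category.assoc,
      P.complex.d_comp_d, Limits.zero_comp, Limits.zero_comp])
  let c' : P.complex.X n ⟶ S.X₂ := f' - c ≫ S.f
  have h1 : P.complex.d (n + 1) n ≫ c' = 0 := by
    rw [Preadditive.comp_sub, ← Category.assoc _ c, hc, hS.exact.lift_f, sub_self]
  have h2 : c' ≫ S.g = f := by
    rw [Preadditive.sub_comp, Category.assoc, S.zero, Limits.comp_zero, sub_zero, hf']
  have h3 := hζ c'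
  rw [← Category.assoc, h2, h0.comm n] at h3
  have h4 : f = (P.complex.d n (n - 1) ≫ h0.hom (n - 1) n) ≫ c' ≫ inv e := by
    rw [← cancel_mono e, ← h3, Category.assoc, Category.assoc, Category.assoc, IsIso.inv_hom_id, Category.comp_id,
      ← Category.assoc, Preadditive.add_comp, Preadditive.add_comp,
      Homotopy.prevD_chainComplex, Category.assoc _ (P.complex.d (n + 1) n), h1,
      Limits.comp_zero, add_zero]
    rw [HomologicalComplex.zero_f, Limits.zero_comp, add_zero]
    cases n with
    | zero => simp
    | succ n => rw [Homotopy.dNext_succ_chainComplex]; rfl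
  exact ⟨h0.hom (n - 1) n ≫ c' ≫ inv e, by rw [h4, Category.assoc]⟩

/-- multiplication by a central element -/
def cmul (c : Subring.center R) (M : ModuleCat.{u} R) : M ⟶ M :=
  ModuleCat.ofHom
    { toFun := fun m => (c : R) • m
      map_add' := smul_add _
      map_smul' := fun u m => by
        rw [RingHom.id_apply, ← mul_smul, ← mul_smul, Subring.mem_center_iff.1 c.2 u] }

theorem cmul_nat (c : Subring.center R) {M N : ModuleCat.{u} R} (f : M ⟶ N) :
    cmul c M ≫ f = f ≫ cmul c N := by
  ext m
  exact map_smul f.hom (c : R) m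

/-- multiplication by a central element on complexes -/
def cmulC (c : Subring.center R) (P : ChainComplex (ModuleCat.{u} R) ℕ) : P ⟶ P where
  f _ := cmul c _
  comm' _ _ _ := cmul_nat c _

theorem cmulC_null (c : Subring.center R) {X : ModuleCat.{u} R} (P : ProjectiveResolution X)
    (h : cmul c X = 0) : Nonempty (Homotopy (cmulC c P.complex) 0) := by
  refine ⟨ProjectiveResolution.liftHomotopyZero _ ?_⟩
  refine HomologicalComplex.to_single_hom_ext ?_
  rw [HomologicalComplex.comp_f]
  change cmul c _ ≫ P.π.f 0 = _
  have : ∀ Y : ModuleCat.{u} R, ∀ (_ : Y ≅ X) (g : P.complex.X 0 ⟶ Y), cmul c _ ≫ g = 0 := by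
    intro Y i g
    rw [← cancel_mono i.hom, Category.assoc, cmul_nat, h, Limits.comp_zero,
      Limits.zero_comp]
  rw [this _ (HomologicalComplex.singleObjXSelf (ComplexShape.down ℕ) 0 X) (P.π.f 0)]
  rfl

theorem van_zero {X : ModuleCat.{u} R} (P : ProjectiveResolution X) (M : ModuleCat.{u} R)
    (f : X ⟶ M) (hf : f ≠ 0) : ¬ Van P M 0 := by
  intro h
  let g := P.π.f 0 ≫ (HomologicalComplex.singleObjXSelf (ComplexShape.down ℕ) 0 X).hom
  have hg : P.complex.d 1 0 ≫ g = 0 := by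
    rw [← Category.assoc, P.complex_d_comp_π_f_zero, Limits.zero_comp]
  obtain ⟨k, hk⟩ := h (g ≫ f) (by rw [← Category.assoc, hg, Limits.zero_comp])
  have h0 : P.complex.d 0 (0 - 1) = 0 := P.complex.shape _ _ (by simp)
  rw [h0, Limits.zero_comp] at hk
  have : Epi g := epi_comp _ _
  exact hf (by rw [← cancel_epi g, ← hk, Limits.comp_zero])

end hom

section fin

variable {F R : Type u} [Field F] [Ring R] [Algebra F R] {d : ℕ} (z : Fin d → Subring.center R)
  {κ : Type} (v : Module.Basis ((Fin d → ℕ) × κ) F R)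
  (hv : ∀ i t a, (z i : R) * v (t, a) = v (t + Pi.single i 1, a))

theorem Nsub_anti {r s : ℕ} (h : r ≤ s) : Nsub F z s ≤ Nsub F z r :=
  fun _ hf => ⟨hf.1, fun i hi => hf.2 i (hi.trans_le h)⟩

variable (F) in
/-- the short complex N_(r+1) → N_r → N_r -/
noncomputable def Ses (r : Fin d) : ShortComplex (ModuleCat.{u} R) where
  X₁ := ModuleCat.of R (Nsub F z (r.val + 1))
  X₂ := ModuleCat.of R (Nsub F z r.val)
  X₃ := ModuleCat.of R (Nsub F z r.val)
  f := ModuleCat.ofHom (Submodule.inclusion (Nsub_anti z (Nat.le_succ _)))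
  g := cmul (z r) _
  zero := by
    ext m
    exact m.2.2 r (Nat.lt_succ_self _)

include hv

theorem ses_exact (r : Fin d) : (Ses F z r).ShortExact where
  exact := by
    rw [ShortComplex.moduleCat_exact_iff]
    intro x hx
    refine ⟨⟨x.1, x.2.1, fun i hi => ?_⟩, rfl⟩
    rcases Nat.lt_succ_iff_lt_or_eq.1 hi with h | h
    · exact x.2.2 i h
    · obtain rfl : i = r := Fin.ext h
      exact congrArg Subtype.val hx
  mono_f := (ModuleCat.mono_iff_injective _).2 (Submodule.inclusion_injective (Nsub_anti z (Nat.le_succ _)))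
  epi_g := (ModuleCat.epi_iff_surjective _).2 fun f => by
    obtain ⟨g, hg, h⟩ := Nsub_surj z v hv r f.1 f.2
    exact ⟨⟨g, hg⟩, Subtype.ext h⟩

theorem upper [Finite κ] {X : ModuleCat.{u} R} (P : ProjectiveResolution X) (r : ℕ) (hr : r ≤ d)
    (n : ℕ) (hn : r < n) : Van P (ModuleCat.of R (Nsub F z r)) n := by
  induction r generalizing n with
  | zero =>
    have h1 : Module.Injective R (Nsub F z 0) := (Nsub_baer z v hv).injective
    have : Injective (ModuleCat.of R (Nsub F z 0)) := Module.injective_object_of_injective_module _ _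
    obtain ⟨m, rfl⟩ := Nat.exists_eq_succ_of_ne_zero hn.ne'
    exact van_inj P _ m
  | succ r ih =>
    obtain ⟨m, rfl⟩ := Nat.exists_eq_succ_of_ne_zero (by omega : n ≠ 0)
    exact van_up P (ses_exact z v hv ⟨r, hr⟩) m (ih (by omega) _ (by omega))
      (ih (by omega) _ (by omega))

theorem lower [Nonempty κ] (P : ProjectiveResolution (ModuleCat.of R (Nsub F z d)))
    (r : ℕ) (hr : r ≤ d) : ¬ Van P (ModuleCat.of R (Nsub F z r)) r := by
  induction r with
  | zero =>
    refine van_zero P _ (ModuleCat.ofHom (Submodule.inclusion (Nsub_anti z (Nat.zero_le _)))) ?_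
    intro h
    obtain ⟨f, hf, hne⟩ := Nsub_ne z v hv
    have := congrArg (fun k => (k.hom ⟨f, hf⟩ : Nsub F z 0).1) h
    exact hne this
  | succ r ih =>
    obtain ⟨h0⟩ := cmulC_null (z ⟨r, hr⟩) P (by
      ext m
      exact m.2.2 ⟨r, hr⟩ hr)
    exact van_low P (ses_exact z v hv ⟨r, hr⟩) r _ h0 (𝟙 _)
      (fun c => (cmul_nat _ c).trans (congrArg (c ≫ ·) (Category.comp_id (cmul (z ⟨r, hr⟩) _)).symm)) (ih (by omega))
      (IsIso.id _)

end fin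

end PBW

/-- Over a field of prime characteristic, for every `0 ≤ r ≤ dim_F 𝔞` there
is a locally finite `U(𝔞)`-module of injective dimension exactly `r`. -/
theorem exists_locallyFinite_module_of_injective_dimension
    (F : Type u) [Field F] (p : ℕ) [Fact p.Prime] [CharP F p]
    (L : Type u) [LieRing L] [LieAlgebra F L] [FiniteDimensional F L]
    (r : ℕ) (hr : r ≤ Module.finrank F L) :
    ∃ N : LieRep F L, N.IsLocallyFinite ∧
      InjDimEq F (UniversalEnvelopingAlgebra F L)
        (ModuleCat.of (UniversalEnvelopingAlgebra F L) N.carrier) r := by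
  obtain ⟨q, z, v, hq, hv⟩ := PBW.exists_basis (Module.finBasis F L) p
  have : Nonempty (∀ i, Fin (q i)) := ⟨fun i => ⟨0, Nat.pos_of_ne_zero (hq i)⟩⟩
  refine ⟨{ carrier := PBW.Nsub F z r }, fun m => ?_, fun X n hn => ?_,
    ModuleCat.of _ (PBW.Nsub F z (Module.finrank F L)), ?_⟩
  · refine PBW.locfin z v hv m fun i => ?_
    obtain ⟨n, hn⟩ := m.2.1 i
    exact ⟨n, Subtype.ext hn⟩
  · exact (PBW.ext_iff (projectiveResolution X) _ n).2 (PBW.upper z v hv _ r hr n hn)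
  · rw [← not_subsingleton_iff_nontrivial, PBW.ext_iff (projectiveResolution _)]
    exact PBW.lower z v hv _ r hr
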